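/- arXiv:1103.6065 — 2 statements merged into one kernel-verified Lean document; each statement's English description precedes it below -/
import Mathlib

section
/- Let X be a real Banach space of almost universal disposition for finite-dimensional spaces, let I be a set, and let 𝒰 be a countably incomplete ultrafilter on I. Then the ultrapower X_𝒰 = ℓ∞(I, X) / N_𝒰 is a Banach space of universal disposition for separable spaces. -/
open scoped ENNReal Topology

/-- Universal disposition for separable spaces. -/
def UnivDispSeparable (U : Type*) [NormedAddCommGroup U] [NormedSpace ℝ U] : Prop :=
  ∀ (A B : Type) [NormedAddCommGroup A] [NormedSpace ℝ A] [CompleteSpace A]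
    [TopologicalSpace.SeparableSpace A]
    [NormedAddCommGroup B] [NormedSpace ℝ B] [CompleteSpace B]
    [TopologicalSpace.SeparableSpace B]
    (u : A →ₗᵢ[ℝ] U) (j : A →ₗᵢ[ℝ] B),
    ∃ u' : B →ₗᵢ[ℝ] U, ∀ a : A, u' (j a) = u a

/-- Almost universal disposition for finite-dimensional spaces. -/
def AlmostUnivDispFinDim (U : Type*) [NormedAddCommGroup U] [NormedSpace ℝ U] : Prop :=
  ∀ (A B : Type) [NormedAddCommGroup A] [NormedSpace ℝ A] [FiniteDimensional ℝ A]
    [NormedAddCommGroup B] [NormedSpace ℝ B] [FiniteDimensional ℝ B]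
    (u : A →ₗᵢ[ℝ] U) (j : A →ₗᵢ[ℝ] B) (ε : ℝ), 0 < ε →
    ∃ u' : B →ₗ[ℝ] U,
      (∀ b : B, (1 + ε)⁻¹ * ‖b‖ ≤ ‖u' b‖ ∧ ‖u' b‖ ≤ (1 + ε) * ‖b‖) ∧
      ∀ a : A, u' (j a) = u a

/-- An ultrafilter is countably incomplete if it contains a decreasing sequence of sets with
empty intersection. -/
def Ultrafilter.CountablyIncomplete {I : Type*} (𝒰 : Ultrafilter I) : Prop :=
  ∃ J : ℕ → Set I, (∀ n, J (n + 1) ⊆ J n) ∧ (∀ n, J n ∈ 𝒰) ∧ ⋂ n, J n = ∅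

variable (I : Type*) (X : Type*) [NormedAddCommGroup X] [NormedSpace ℝ X]

/-- The closed subspace `N_𝒰 = {(x_i) ∈ ℓ∞(I, X) : ‖x_i‖ → 0 along 𝒰}`. -/
noncomputable def nullUltraIdeal (𝒰 : Ultrafilter I) : Submodule ℝ (lp (fun _ : I => X) ∞) where
  carrier := {f | Filter.Tendsto (fun i => ‖f i‖) (𝒰 : Filter I) (𝓝 0)}
  zero_mem' := by
    simp only [Set.mem_setOf_eq, lp.coeFn_zero, Pi.zero_apply, norm_zero]
    exact tendsto_const_nhds
  add_mem' := by
    intro f g hf hg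
    refine squeeze_zero (fun i => norm_nonneg _) (fun i => ?_) (by simpa using hf.add hg)
    simpa [lp.coeFn_add] using norm_add_le (f i) (g i)
  smul_mem' := by
    intro c f hf
    have : Filter.Tendsto (fun i => ‖c‖ * ‖f i‖) (𝒰 : Filter I) (𝓝 0) := by
      simpa using hf.const_mul ‖c‖
    simpa [lp.coeFn_smul, Pi.smul_apply, norm_smul] using this

theorem isClosed_nullUltraIdeal (𝒰 : Ultrafilter I) :
    IsClosed ((nullUltraIdeal I X 𝒰 : Set (lp (fun _ : I => X) ∞))) := by
  refine isClosed_of_closure_subset ?_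
  intro g hg
  show Filter.Tendsto (fun i => ‖g i‖) (𝒰 : Filter I) (𝓝 0)
  rw [Metric.tendsto_nhds]
  intro ε hε
  obtain ⟨f, hfmem, hfg⟩ := Metric.mem_closure_iff.1 hg (ε / 2) (by linarith)
  have hf : Filter.Tendsto (fun i => ‖f i‖) (𝒰 : Filter I) (𝓝 0) := hfmem
  have h1 : ∀ᶠ i in (𝒰 : Filter I), ‖f i‖ < ε / 2 := by
    have := Metric.tendsto_nhds.1 hf (ε / 2) (by linarith)
    filter_upwards [this] with i hi
    calc ‖f i‖ ≤ |‖f i‖| := le_abs_self _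
    _ = dist ‖f i‖ 0 := by rw [Real.dist_eq, sub_zero]
    _ < ε / 2 := hi
  filter_upwards [h1] with i hi
  have h2 : ‖g i - f i‖ ≤ ‖g - f‖ := by
    simpa [lp.coeFn_sub] using lp.norm_apply_le_norm ENNReal.top_ne_zero (g - f) i
  have h3 : ‖g i‖ ≤ ‖f i‖ + ‖g i - f i‖ := by
    simpa using norm_add_le (f i) (g i - f i)
  have h4 : ‖g - f‖ < ε / 2 := by simpa [dist_eq_norm] using hfg
  rw [Real.dist_eq, sub_zero, abs_of_nonneg (norm_nonneg _)]
  linarith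

noncomputable instance (𝒰 : Ultrafilter I) :
    NormedAddCommGroup (lp (fun _ : I => X) ∞ ⧸ nullUltraIdeal I X 𝒰) :=
  @Submodule.Quotient.normedAddCommGroup _ _ _ _ _ (nullUltraIdeal I X 𝒰)
    (isClosed_nullUltraIdeal I X 𝒰)

noncomputable instance (𝒰 : Ultrafilter I) :
    NormedSpace ℝ (lp (fun _ : I => X) ∞ ⧸ nullUltraIdeal I X 𝒰) :=
  Submodule.Quotient.normedSpace _ ℝ

section

variable {I X}

/-- The defining property of a space of almost universal disposition, for norms given as definite
seminorms. -/
theorem AlmostUnivDispFinDim.exists_extension_seminorm (hX : AlmostUnivDispFinDim X)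
    {A B : Type} [AddCommGroup A] [Module ℝ A] [FiniteDimensional ℝ A]
    [AddCommGroup B] [Module ℝ B] [FiniteDimensional ℝ B]
    (p : Seminorm ℝ B) (hp : ∀ b, p b = 0 → b = 0) (j : A →ₗ[ℝ] B) (hj : Function.Injective j)
    (T : A →ₗ[ℝ] X) (hT : ∀ a, ‖T a‖ = p (j a)) {ε : ℝ} (hε : 0 < ε) :
    ∃ v : B →ₗ[ℝ] X, (∀ b, (1 + ε)⁻¹ * p b ≤ ‖v b‖ ∧ ‖v b‖ ≤ (1 + ε) * p b) ∧
      ∀ a, v (j a) = T a := by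
  let : Norm B := ⟨p⟩
  have core : NormedSpace.Core ℝ B :=
    { norm_nonneg := apply_nonneg p
      norm_smul := map_smul_eq_mul p
      norm_triangle := map_add_le_add p
      norm_eq_zero_iff := fun b => ⟨hp b, fun h => h ▸ map_zero p⟩ }
  let : NormedAddCommGroup B := NormedAddCommGroup.ofCore core
  let : NormedSpace ℝ B := NormedSpace.ofCore core
  let : NormedAddCommGroup A := NormedAddCommGroup.induced A B j hj
  let : NormedSpace ℝ A := NormedSpace.induced ℝ A B j
  exact hX A B ⟨T, hT⟩ ⟨j, fun _ => rfl⟩ ε hε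

/-- In a space of almost universal disposition, almost isometric maps extend to almost isometric
maps. -/
theorem AlmostUnivDispFinDim.exists_extension (hX : AlmostUnivDispFinDim X)
    {A B : Type} [NormedAddCommGroup A] [NormedSpace ℝ A] [FiniteDimensional ℝ A]
    [NormedAddCommGroup B] [NormedSpace ℝ B] [FiniteDimensional ℝ B]
    (j : A →ₗᵢ[ℝ] B) (T : A →ₗ[ℝ] X) {δ : ℝ} (hδ : 0 < δ)
    (hT : ∀ a, (1 + δ)⁻¹ * ‖a‖ ≤ ‖T a‖ ∧ ‖T a‖ ≤ (1 + δ) * ‖a‖) :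
    ∃ v : B →ₗ[ℝ] X,
      (∀ b, ((1 + δ) ^ 2)⁻¹ * ‖b‖ ≤ ‖v b‖ ∧ ‖v b‖ ≤ (1 + δ) ^ 2 * ‖b‖) ∧
      ∀ a, v (j a) = T a := by
  have hc : 0 < 1 + δ := by linarith
  have hc1 : (1 + δ)⁻¹ ≤ 1 + δ := (inv_le_one_of_one_le₀ (by linarith)).trans (by linarith)
  let g : B → A → ℝ := fun b a => ‖T a‖ + (1 + δ) * ‖b - j a‖
  have hg0 : ∀ b a, 0 ≤ g b a := fun b a => by positivity
  have hbdd : ∀ b, BddBelow (Set.range (g b)) := fun b => ⟨0, by rintro _ ⟨a, rfl⟩; exact hg0 b a⟩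
  let p : Seminorm ℝ B := Seminorm.ofSMulLE (fun b => ⨅ a, g b a)
    (le_antisymm (ciInf_le_of_le (hbdd 0) 0 (by simp [g])) (Real.iInf_nonneg (hg0 0)))
    (fun x y => by
      refine le_ciInf_add_ciInf fun a b => ciInf_le_of_le (hbdd _) (a + b) ?_
      have h1 := norm_add_le (T a) (T b)
      have h2 := norm_add_le (x - j a) (y - j b)
      rw [← map_add] at h1
      rw [show x - j a + (y - j b) = x + y - j (a + b) by rw [map_add]; abel] at h2
      have := mul_le_mul_of_nonneg_left h2 hc.le
      simp only [g]
      linarith)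
    (fun r x => by
      rw [Real.mul_iInf_of_nonneg (norm_nonneg r)]
      refine le_ciInf fun a => ciInf_le_of_le (hbdd _) (r • a) (le_of_eq ?_)
      simp only [g, map_smul, ← smul_sub, norm_smul]
      ring)
  have hple : ∀ b, p b ≤ (1 + δ) * ‖b‖ := fun b =>
    ciInf_le_of_le (hbdd b) 0 (by simp [g])
  have hlep : ∀ b, (1 + δ)⁻¹ * ‖b‖ ≤ p b := fun b => by
    refine le_ciInf fun a => ?_
    have h1 : ‖b‖ ≤ ‖a‖ + ‖b - j a‖ := by
      simpa using norm_add_le (j a) (b - j a)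
    calc (1 + δ)⁻¹ * ‖b‖ ≤ (1 + δ)⁻¹ * (‖a‖ + ‖b - j a‖) := by gcongr
      _ = (1 + δ)⁻¹ * ‖a‖ + (1 + δ)⁻¹ * ‖b - j a‖ := by ring
      _ ≤ g b a := add_le_add (hT a).1 (by gcongr)
  have hpj : ∀ a, ‖T a‖ = p (j a) := fun a => by
    refine le_antisymm (le_ciInf fun a' => ?_) (ciInf_le_of_le (hbdd _) a (by simp [g]))
    have h1 : ‖T a‖ ≤ ‖T a'‖ + ‖T (a - a')‖ := by
      simpa using norm_add_le (T a') (T (a - a'))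
    have h2 := (hT (a - a')).2
    rw [← j.norm_map, map_sub j] at h2
    simp only [g]
    linarith
  obtain ⟨v, hv, hvj⟩ := hX.exists_extension_seminorm p
    (fun b hb => by
      have h := hlep b
      rw [hb] at h
      have := nonpos_of_mul_nonpos_right h (inv_pos.2 hc)
      exact norm_le_zero_iff.1 this)
    j.toLinearMap j.injective T hpj hδ
  refine ⟨v, fun b => ⟨?_, ?_⟩, hvj⟩
  · calc ((1 + δ) ^ 2)⁻¹ * ‖b‖ = (1 + δ)⁻¹ * ((1 + δ)⁻¹ * ‖b‖) := by rw [sq, mul_inv, mul_assoc]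
      _ ≤ (1 + δ)⁻¹ * p b := by gcongr; exact hlep b
      _ ≤ ‖v b‖ := (hv b).1
  · calc ‖v b‖ ≤ (1 + δ) * p b := (hv b).2
      _ ≤ (1 + δ) * ((1 + δ) * ‖b‖) := by gcongr; exact hple b
      _ = (1 + δ) ^ 2 * ‖b‖ := by ring

/-- Linear maps on a finite-dimensional space whose norms converge pointwise to the norm along an
ultrafilter are eventually almost isometric. -/
theorem Ultrafilter.eventually_norm_bounds {F : Type*} [NormedAddCommGroup F] [NormedSpace ℝ F]
    [FiniteDimensional ℝ F] (𝒰 : Ultrafilter I) (s : I → F →ₗ[ℝ] X)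
    (hs : ∀ a, Filter.Tendsto (fun i => ‖s i a‖) 𝒰 (𝓝 ‖a‖)) {δ : ℝ} (hδ : 0 < δ) :
    ∀ᶠ i in (𝒰 : Filter I), ∀ a, (1 + δ)⁻¹ * ‖a‖ ≤ ‖s i a‖ ∧ ‖s i a‖ ≤ (1 + δ) * ‖a‖ := by
  obtain ⟨C, hC, hbound⟩ : ∃ C > 0, ∀ᶠ i in (𝒰 : Filter I), ∀ a, ‖s i a‖ ≤ C * ‖a‖ := by
    let e := Module.finBasis ℝ F
    obtain ⟨C, hC, h⟩ := e.exists_opNorm_le (F := X)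
    obtain ⟨M, hM⟩ := (Set.finite_range fun k => ‖e k‖).bddAbove
    have hM' : ∀ k, ‖e k‖ ≤ M := fun k => hM ⟨k, rfl⟩
    refine ⟨C * (|M| + 1), by positivity, ?_⟩
    have : ∀ᶠ i in (𝒰 : Filter I), ∀ k, ‖s i (e k)‖ < |M| + 1 :=
      Filter.eventually_all.2 fun k => (hs (e k)).eventually_lt_const
        (((hM' k).trans (le_abs_self M)).trans_lt (lt_add_one _))
    filter_upwards [this] with i hi a
    exact (LinearMap.toContinuousLinearMap (s i)).le_of_opNorm_le
      (h (by positivity) fun k => (hi k).le) a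
  have hsphere : ∀ᶠ i in (𝒰 : Filter I), ∀ a, ‖a‖ = 1 →
      (1 + δ)⁻¹ < ‖s i a‖ ∧ ‖s i a‖ < 1 + δ := by
    by_contra hcon
    rw [← Ultrafilter.eventually_not] at hcon
    have hex : ∀ i, ∃ a : F, (∃ a : F, ‖a‖ = 1 ∧ ¬ ((1 + δ)⁻¹ < ‖s i a‖ ∧ ‖s i a‖ < 1 + δ)) →
        ‖a‖ = 1 ∧ ¬ ((1 + δ)⁻¹ < ‖s i a‖ ∧ ‖s i a‖ < 1 + δ) := fun i => by
      by_cases h : ∃ a : F, ‖a‖ = 1 ∧ ¬ ((1 + δ)⁻¹ < ‖s i a‖ ∧ ‖s i a‖ < 1 + δ)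
      · exact ⟨h.choose, fun _ => h.choose_spec⟩
      · exact ⟨0, fun h' => absurd h' h⟩
    choose x hx using hex
    have hx' : ∀ᶠ i in (𝒰 : Filter I),
        ‖x i‖ = 1 ∧ ¬ ((1 + δ)⁻¹ < ‖s i (x i)‖ ∧ ‖s i (x i)‖ < 1 + δ) := by
      filter_upwards [hcon] with i hi
      push Not at hi
      obtain ⟨a, ha, h⟩ := hi
      exact hx i ⟨a, ha, fun h' => absurd h'.2 (h h'.1).not_gt⟩
    obtain ⟨a, ha, hlim⟩ := (isCompact_sphere (0 : F) 1).ultrafilter_le_nhds (𝒰.map x)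
      (Filter.le_principal_iff.2 (by
        rw [Ultrafilter.mem_coe, Ultrafilter.mem_map]
        filter_upwards [hx'] with i hi
        simpa using hi.1))
    have hxa : Filter.Tendsto x 𝒰 (𝓝 a) := hlim
    have ha1 : ‖a‖ = 1 := by simpa using ha
    have hdiff : Filter.Tendsto (fun i => s i (x i) - s i a) 𝒰 (𝓝 0) := by
      refine squeeze_zero_norm' (a := fun i => C * ‖x i - a‖) ?_ ?_
      · filter_upwards [hbound] with i hi
        simpa using hi (x i - a)
      · simpa using ((hxa.sub_const a).norm).const_mul C
    have hnorm : Filter.Tendsto (fun i => ‖s i (x i)‖) 𝒰 (𝓝 1) := by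
      have h := hs a
      rw [ha1] at h
      have h0 : Filter.Tendsto (fun i => ‖s i (x i)‖ - ‖s i a‖) 𝒰 (𝓝 0) :=
        squeeze_zero_norm (fun i => abs_norm_sub_norm_le _ _) (by simpa using hdiff.norm)
      simpa using h0.add h
    have h1 := hnorm.eventually_lt_const (show 1 < 1 + δ by linarith)
    have h2 := hnorm.eventually_const_lt (inv_lt_one_of_one_lt₀ (show 1 < 1 + δ by linarith))
    obtain ⟨i, hi, h1, h2⟩ := (hx'.and (h1.and h2)).exists
    exact hi.2 ⟨h2, h1⟩
  filter_upwards [hsphere] with i hi a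
  rcases eq_or_ne a 0 with rfl | ha
  · simp
  have hpos := norm_pos_iff.2 ha
  obtain ⟨h1, h2⟩ := hi (‖a‖⁻¹ • a) (by
    rw [norm_smul, norm_inv, norm_norm, inv_mul_cancel₀ hpos.ne'])
  rw [map_smul, norm_smul, norm_inv, norm_norm, inv_mul_eq_div] at h1 h2
  exact ⟨((lt_div_iff₀ hpos).1 h1).le, ((div_lt_iff₀ hpos).1 h2).le⟩

/-- Bounded families that agree eventually define the same element of the ultrapower. -/
theorem mk_eq_mk_of_eventuallyEq {𝒰 : Ultrafilter I} {f g : lp (fun _ : I => X) ∞}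
    (h : ∀ᶠ i in (𝒰 : Filter I), f i = g i) :
    (Submodule.Quotient.mk f : lp (fun _ : I => X) ∞ ⧸ nullUltraIdeal I X 𝒰) =
      Submodule.Quotient.mk g := by
  rw [Submodule.Quotient.eq]
  refine tendsto_const_nhds.congr' ?_
  filter_upwards [h] with i hi
  simp [hi]

/-- A family that is eventually bounded along the ultrafilter agrees eventually with a bounded
family. -/
theorem exists_lp_eventuallyEq {Y : Type*} [NormedAddCommGroup Y] (𝒰 : Ultrafilter I)
    (w : I → Y) {C : ℝ} (hC : 0 ≤ C)
    (h : ∀ᶠ i in (𝒰 : Filter I), ‖w i‖ ≤ C) :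
    ∃ f : lp (fun _ : I => Y) ∞, ‖f‖ ≤ C ∧ ∀ᶠ i in (𝒰 : Filter I), f i = w i := by
  classical
  have hle : ∀ i, ‖if ‖w i‖ ≤ C then w i else 0‖ ≤ C := fun i => by
    split_ifs with hi
    · exact hi
    · simpa using hC
  refine ⟨⟨fun i => if ‖w i‖ ≤ C then w i else 0,
    memℓp_infty ⟨C, by rintro _ ⟨i, rfl⟩; exact hle i⟩⟩, lp.norm_le_of_forall_le hC hle, ?_⟩
  filter_upwards [h] with i hi
  exact if_pos hi

/-- The norm of an element of the ultrapower is the limit of the norms of its components. -/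
theorem tendsto_norm_mk (𝒰 : Ultrafilter I) (f : lp (fun _ : I => X) ∞) :
    Filter.Tendsto (fun i => ‖f i‖) 𝒰
      (𝓝 ‖(Submodule.Quotient.mk f : lp (fun _ : I => X) ∞ ⧸ nullUltraIdeal I X 𝒰)‖) := by
  have hle : ∀ C, (∀ᶠ i in (𝒰 : Filter I), ‖f i‖ ≤ C) →
      ‖(Submodule.Quotient.mk f : lp (fun _ : I => X) ∞ ⧸ nullUltraIdeal I X 𝒰)‖ ≤ C := by
    intro C hC
    obtain ⟨i, hi⟩ := hC.exists
    obtain ⟨g, hg, hgf⟩ := exists_lp_eventuallyEq 𝒰 f ((norm_nonneg _).trans hi) hC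
    rw [← mk_eq_mk_of_eventuallyEq hgf]
    exact (Submodule.Quotient.norm_mk_le _ g).trans hg
  refine tendsto_order.2 ⟨fun a ha => ?_, fun a ha => ?_⟩
  · by_contra hcon
    rw [← Ultrafilter.eventually_not] at hcon
    exact (hle a (hcon.mono fun i hi => not_lt.1 hi)).not_gt ha
  · obtain ⟨g, hg, hlt⟩ := Submodule.Quotient.norm_mk_lt
      (Submodule.Quotient.mk f : lp (fun _ : I => X) ∞ ⧸ nullUltraIdeal I X 𝒰)
      (half_pos (sub_pos.2 ha))
    have hnull : Filter.Tendsto (fun i => ‖(f - g) i‖) 𝒰 (𝓝 0) :=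
      (Submodule.Quotient.eq _).1 hg.symm
    filter_upwards [hnull.eventually_lt_const (half_pos (sub_pos.2 ha))] with i hi
    have h1 : ‖f i‖ ≤ ‖(f - g) i‖ + ‖g i‖ := by
      simpa [lp.coeFn_sub] using norm_add_le ((f - g) i) (g i)
    have h2 := lp.norm_apply_le_norm ENNReal.top_ne_zero g i
    replace hlt : ‖g‖ < ‖(Submodule.Quotient.mk f :
      lp (fun _ : I => X) ∞ ⧸ nullUltraIdeal I X 𝒰)‖ + _ := hlt
    linarith

/-- A family of linear maps whose norms converge pointwise to the norm induces a linear isometry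
into the ultrapower. -/
theorem exists_linearIsometry_ultrapower {V : Type*} [NormedAddCommGroup V] [NormedSpace ℝ V]
    (𝒰 : Ultrafilter I) (W : I → V →ₗ[ℝ] X)
    (hW : ∀ b, Filter.Tendsto (fun i => ‖W i b‖) 𝒰 (𝓝 ‖b‖)) :
    ∃ τ : V →ₗᵢ[ℝ] (lp (fun _ : I => X) ∞ ⧸ nullUltraIdeal I X 𝒰),
      ∀ b (f : lp (fun _ : I => X) ∞), (∀ᶠ i in (𝒰 : Filter I), f i = W i b) →
        τ b = Submodule.Quotient.mk f := by
  have hex : ∀ b, ∃ f : lp (fun _ : I => X) ∞, ∀ᶠ i in (𝒰 : Filter I), f i = W i b := fun b =>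
    (exists_lp_eventuallyEq 𝒰 (fun i => W i b) (by positivity : 0 ≤ ‖b‖ + 1)
      ((hW b).eventually_le_const (lt_add_one _))).imp fun _ h => h.2
  choose f hf using hex
  let τ : V →ₗ[ℝ] (lp (fun _ : I => X) ∞ ⧸ nullUltraIdeal I X 𝒰) :=
    { toFun := fun b => Submodule.Quotient.mk (f b)
      map_add' := fun b c => by
        rw [← Submodule.Quotient.mk_add]
        refine mk_eq_mk_of_eventuallyEq ?_
        filter_upwards [hf b, hf c, hf (b + c)] with i h1 h2 h3
        simp [h1, h2, h3]
      map_smul' := fun r b => by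
        rw [RingHom.id_apply, ← Submodule.Quotient.mk_smul]
        refine mk_eq_mk_of_eventuallyEq ?_
        filter_upwards [hf b, hf (r • b)] with i h1 h2
        simp [lp.coeFn_smul, h1, h2] }
  refine ⟨⟨τ, fun b => ?_⟩, fun b g hg => ?_⟩
  · refine tendsto_nhds_unique (tendsto_norm_mk 𝒰 (f b)) ((hW b).congr' ?_)
    filter_upwards [hf b] with i hi
    rw [hi]
  · refine mk_eq_mk_of_eventuallyEq ?_
    filter_upwards [hf b, hg] with i h1 h2
    rw [h1, h2]

/-- For a countably incomplete ultrafilter, if each of countably many properties holds eventually,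
then one can choose for each index one of these properties, which eventually holds, with the choice
tending to infinity. -/
theorem Ultrafilter.CountablyIncomplete.exists_tendsto_atTop {𝒰 : Ultrafilter I}
    (h𝒰 : 𝒰.CountablyIncomplete) (P : ℕ → I → Prop)
    (hP : ∀ n, ∀ᶠ i in (𝒰 : Filter I), P n i) :
    ∃ N : I → ℕ, Filter.Tendsto N 𝒰 Filter.atTop ∧ ∀ᶠ i in (𝒰 : Filter I), P (N i) i := by
  classical
  obtain ⟨J, hJ, hmem, hempty⟩ := h𝒰
  have hanti : Antitone J := antitone_nat_of_succ_le hJ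
  have hout : ∀ i, ∃ k, i ∉ J k := fun i => by
    by_contra! h
    exact (hempty ▸ Set.mem_iInter.2 h : i ∈ (∅ : Set I))
  choose k hk using hout
  have hlt : ∀ {i n}, i ∈ J n → n ≤ k i := fun {i n} hi =>
    le_of_not_ge fun h => hk i (hanti h hi)
  refine ⟨fun i => Nat.findGreatest (fun n => i ∈ J n ∧ P n i) (k i),
    Filter.tendsto_atTop.2 fun n => ?_, ?_⟩
  · filter_upwards [hmem n, hP n] with i h1 h2
    exact Nat.le_findGreatest (hlt h1) ⟨h1, h2⟩
  · filter_upwards [hmem 0, hP 0] with i h1 h2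
    exact (Nat.findGreatest_spec (P := fun n => i ∈ J n ∧ P n i) (hlt h1) ⟨h1, h2⟩).2

/-- A linear isometry on a dense submodule with values in a Banach space extends. -/
theorem exists_linearIsometry_extension {B U : Type*} [NormedAddCommGroup B] [NormedSpace ℝ B]
    [NormedAddCommGroup U] [NormedSpace ℝ U] [CompleteSpace U] (S : Submodule ℝ B)
    (hS : Dense (S : Set B)) (τ : S →ₗᵢ[ℝ] U) :
    ∃ τ' : B →ₗᵢ[ℝ] U, ∀ b : S, τ' b = τ b := by
  have hd : DenseRange S.subtypeL := by simpa [DenseRange] using hS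
  have he : IsUniformInducing S.subtypeL := isUniformEmbedding_subtype_val.isUniformInducing
  have heq : ∀ b : S, τ.toContinuousLinearMap.extend S.subtypeL b = τ b := fun b =>
    ContinuousLinearMap.extend_eq _ hd he b
  refine ⟨⟨(τ.toContinuousLinearMap.extend S.subtypeL).toLinearMap, fun b => ?_⟩, heq⟩
  refine hd.induction_on (p := fun b => ‖τ.toContinuousLinearMap.extend S.subtypeL b‖ = ‖b‖) b
    (isClosed_eq (by fun_prop) continuous_norm) fun c => ?_
  rw [Submodule.subtypeL_apply, heq, τ.norm_map, Submodule.coe_norm]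

/-- For an isometry between separable spaces, the codomain has an increasing sequence of
finite-dimensional subspaces whose union and its preimage are both dense. -/
theorem exists_monotone_finiteDimensional {A B : Type*} [NormedAddCommGroup A]
    [NormedSpace ℝ A] [TopologicalSpace.SeparableSpace A] [NormedAddCommGroup B]
    [NormedSpace ℝ B] [TopologicalSpace.SeparableSpace B] (j : A →ₗᵢ[ℝ] B) :
    ∃ E : ℕ → Submodule ℝ B, Monotone E ∧ (∀ n, FiniteDimensional ℝ (E n)) ∧
      Dense ((⨆ n, E n : Submodule ℝ B) : Set B) ∧ Dense {a : A | j a ∈ ⨆ n, E n} := by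
  let d := TopologicalSpace.denseSeq A
  let e := TopologicalSpace.denseSeq B
  let E : ℕ → Submodule ℝ B := fun n =>
    Submodule.span ℝ ((fun k => j (d k)) '' Set.Iic n ∪ e '' Set.Iic n)
  have hle : ∀ n, E n ≤ ⨆ n, E n := le_iSup E
  refine ⟨E, fun m n h => Submodule.span_mono ?_, fun n => ?_, ?_, ?_⟩
  · gcongr
  · exact FiniteDimensional.span_of_finite ℝ
      (((Set.finite_Iic n).image _).union ((Set.finite_Iic n).image _))
  · refine (TopologicalSpace.denseRange_denseSeq B).mono ?_
    rintro _ ⟨n, rfl⟩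
    exact hle n (Submodule.subset_span (Or.inr ⟨n, Set.mem_Iic.2 le_rfl, rfl⟩))
  · refine (TopologicalSpace.denseRange_denseSeq A).mono ?_
    rintro _ ⟨n, rfl⟩
    exact hle n (Submodule.subset_span (Or.inl ⟨n, Set.mem_Iic.2 le_rfl, rfl⟩))

end

/-- Ultrapowers of a Banach space of almost universal disposition for finite-dimensional
spaces with respect to countably incomplete ultrafilters are of universal disposition for
separable spaces. -/
theorem ultrapower_univDispSeparable [CompleteSpace X]
    (hX : AlmostUnivDispFinDim X) (𝒰 : Ultrafilter I)
    (h𝒰 : 𝒰.CountablyIncomplete) :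
    UnivDispSeparable (lp (fun _ : I => X) ∞ ⧸ nullUltraIdeal I X 𝒰) := by
  intro A B _ _ _ _ _ _ _ _ u j
  obtain ⟨E, hmono, hfin, hdB, hdA⟩ := exists_monotone_finiteDimensional j
  obtain ⟨σ, hσ⟩ := (nullUltraIdeal I X 𝒰).mkQ.exists_rightInverse_of_surjective
    (Submodule.range_mkQ _)
  have hmk : ∀ a, Submodule.Quotient.mk (σ (u a)) = u a := fun a =>
    LinearMap.congr_fun hσ (u a)
  let s : I → A →ₗ[ℝ] X := fun i =>
    { toFun := fun a => σ (u a) i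
      map_add' := fun a b => by simp
      map_smul' := fun r a => by simp [lp.coeFn_smul] }
  have hs : ∀ a, Filter.Tendsto (fun i => ‖s i a‖) 𝒰 (𝓝 ‖a‖) := fun a => by
    have h := tendsto_norm_mk 𝒰 (σ (u a))
    rwa [hmk, u.norm_map] at h
  let δ : ℕ → ℝ := fun n => 1 / ((n : ℝ) + 1)
  have hδ : ∀ n, 0 < δ n := fun n => by positivity
  let P : ℕ → I → (B →ₗ[ℝ] X) → Prop := fun n i v =>
    (∀ b ∈ E n, ((1 + δ n) ^ 2)⁻¹ * ‖b‖ ≤ ‖v b‖ ∧ ‖v b‖ ≤ (1 + δ n) ^ 2 * ‖b‖) ∧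
      ∀ a, j a ∈ E n → v (j a) = s i a
  have hP : ∀ n, ∀ᶠ i in (𝒰 : Filter I), ∃ v, P n i v := fun n => by
    let F : Submodule ℝ A := (E n).comap j.toLinearMap
    let jF : F →ₗᵢ[ℝ] E n := ⟨j.toLinearMap.restrict fun _ h => h, fun a => j.norm_map a⟩
    have := hfin n
    have : FiniteDimensional ℝ F :=
      FiniteDimensional.of_injective jF.toLinearMap jF.injective
    filter_upwards [𝒰.eventually_norm_bounds (fun i => (s i).domRestrict F)
      (fun a => hs a) (hδ n)] with i hi
    obtain ⟨v, hv, hvj⟩ := hX.exists_extension jF ((s i).domRestrict F) (hδ n) hi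
    obtain ⟨w, hw⟩ := v.exists_extend
    have hw' : ∀ b : E n, w b = v b := fun b => LinearMap.congr_fun hw b
    exact ⟨w, fun b hb => hw' ⟨b, hb⟩ ▸ hv ⟨b, hb⟩,
      fun a ha => (hw' (jF ⟨a, ha⟩)).trans (hvj ⟨a, ha⟩)⟩
  obtain ⟨N, hN, hPN⟩ := h𝒰.exists_tendsto_atTop _ hP
  choose! W hW using fun i (h : ∃ v, P (N i) i v) => h
  replace hW : ∀ᶠ i in (𝒰 : Filter I), P (N i) i (W i) := hPN.mono hW
  have hmem : ∀ b ∈ ⨆ n, E n, ∀ᶠ i in (𝒰 : Filter I), b ∈ E (N i) := fun b hb => by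
    obtain ⟨n, hn⟩ := (Submodule.mem_iSup_of_directed E hmono.directed_le).1 hb
    exact (hN.eventually_ge_atTop n).mono fun i hi => hmono hi hn
  have hlim : Filter.Tendsto (fun i => (1 + δ (N i)) ^ 2) 𝒰 (𝓝 1) := by
    simpa [δ] using ((tendsto_one_div_add_atTop_nhds_zero_nat.comp hN).const_add (1 : ℝ)).pow 2
  obtain ⟨τ, hτ⟩ := exists_linearIsometry_ultrapower 𝒰
    (fun i => (W i).domRestrict (⨆ n, E n)) fun b => by
      refine tendsto_of_tendsto_of_tendsto_of_le_of_le'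
        (g := fun i => ((1 + δ (N i)) ^ 2)⁻¹ * ‖b‖) (h := fun i => (1 + δ (N i)) ^ 2 * ‖b‖)
        (by simpa using (hlim.inv₀ one_ne_zero).mul_const ‖b‖)
        (by simpa using hlim.mul_const ‖b‖) ?_ ?_
      · filter_upwards [hW, hmem b b.2] with i h1 h2 using (h1.1 b h2).1
      · filter_upwards [hW, hmem b b.2] with i h1 h2 using (h1.1 b h2).2
  have : CompleteSpace (lp (fun _ : I => X) ∞ ⧸ nullUltraIdeal I X 𝒰) :=
    Submodule.Quotient.completeSpace _
  obtain ⟨u', hu'⟩ := exists_linearIsometry_extension _ hdB τ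
  refine ⟨u', congr_fun (Continuous.ext_on hdA (u'.continuous.comp j.continuous) u.continuous
    fun a ha => ?_)⟩
  rw [← hmk a, hu' ⟨j a, ha⟩]
  refine hτ _ _ ?_
  filter_upwards [hW, hmem _ ha] with i h1 h2
  exact (h1.2 a h2).symm
end

section
/- Let X be a real Banach space of almost universal disposition for finite-dimensional spaces, let I be a set, and let 𝒰 be a countably incomplete ultrafilter on I. Then the ultrapower X_𝒰 = ℓ∞(I, X) / N_𝒰 is not a direct factor of any C(K)-space: for every compact Hausdorff topological space K there do not exist bounded linear operators e : X_𝒰 → C(K, ℝ) and π : C(K, ℝ) → X_𝒰 with π ∘ e = id. -/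
open scoped ENNReal Topology

variable (I : Type*) (X : Type*) [NormedAddCommGroup X] [NormedSpace ℝ X]

theorem apply_le_apply_mul_add {K E : Type*} [TopologicalSpace K] [CompactSpace K]
    [NormedAddCommGroup E] [NormedSpace ℝ E] (π : C(K, ℝ) →L[ℝ] E) (φ : E →L[ℝ] ℝ)
    (hφ : ‖φ‖ ≤ 1) (h : C(K, ℝ)) (hh : ‖h‖ ≤ 1) (G H : C(K, ℝ)) (hHG : ∀ k, |H k| ≤ G k)
    (hG : ∀ k, G k ≤ 1) : φ (π H) ≤ φ (π (h * G)) + (‖π‖ - φ (π h)) := by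
  have hn : ‖h * (1 - G) + H‖ ≤ 1 := by
    rw [ContinuousMap.norm_le _ zero_le_one]
    intro k
    have h1 : |h k| ≤ 1 := (h.norm_coe_le_norm k).trans hh
    have h2 : |h k * (1 - G k)| ≤ 1 - G k := by
      rw [abs_mul, abs_of_nonneg (sub_nonneg.2 (hG k))]
      exact mul_le_of_le_one_left (sub_nonneg.2 (hG k)) h1
    calc ‖(h * (1 - G) + H) k‖ = |h k * (1 - G k) + H k| := rfl
      _ ≤ |h k * (1 - G k)| + |H k| := abs_add_le _ _
      _ ≤ 1 := by linarith [hHG k]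
  have hle : φ (π (h * (1 - G) + H)) ≤ ‖π‖ := calc
    φ (π (h * (1 - G) + H)) ≤ ‖φ (π (h * (1 - G) + H))‖ := le_abs_self _
    _ ≤ 1 * ‖π (h * (1 - G) + H)‖ := φ.le_of_opNorm_le hφ _
    _ ≤ ‖π‖ := by
      rw [one_mul]
      exact π.unit_le_opNorm _ hn
  have heq : h * (1 - G) + H = h - h * G + H := by ring
  rw [heq] at hle
  simp only [map_add, map_sub] at hle
  linarith

theorem exists_functionals {E W : Type*} [NormedAddCommGroup E] [NormedSpace ℝ E]
    [NormedAddCommGroup W] [NormedSpace ℝ W]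
    {ρ : ℝ} (hρ : 1 < ρ) (u : W →ₗ[ℝ] E) (hu : ∀ w, ‖w‖ ≤ ρ * ‖u w‖) (f : W →L[ℝ] ℝ)
    (hf : ‖f‖ ≤ 1) :
    ∃ φ : E →L[ℝ] ℝ, ‖φ‖ ≤ ρ⁻¹ ∧ ∀ w, φ (u w) = (ρ ^ 2)⁻¹ * f w := by
  have hρ0 : 0 < ρ := by linarith
  have hinj : Function.Injective u := by
    rw [injective_iff_map_eq_zero]
    intro w hw
    simpa [hw] using hu w
  let g : LinearMap.range u →L[ℝ] ℝ :=
    ((f : W →ₗ[ℝ] ℝ) ∘ₗ (LinearEquiv.ofInjective u hinj).symm.toLinearMap).mkContinuous ρ <| by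
      rintro ⟨_, w, rfl⟩
      have : (LinearEquiv.ofInjective u hinj).symm ⟨u w, w, rfl⟩ = w := by
        rw [LinearEquiv.symm_apply_eq]; rfl
      simp only [LinearMap.comp_apply, LinearEquiv.coe_coe, this]
      exact ((f.le_of_opNorm_le hf w).trans_eq (one_mul _)).trans (hu w)
  obtain ⟨ψ, hψ, hψn⟩ := exists_extension_norm_eq _ g
  refine ⟨(ρ ^ 2)⁻¹ • ψ, ?_, fun w => ?_⟩
  · have h1 : ‖ψ‖ ≤ ρ := hψn.trans_le (LinearMap.mkContinuous_norm_le _ hρ0.le _)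
    rw [norm_smul, Real.norm_of_nonneg (by positivity)]
    calc (ρ ^ 2)⁻¹ * ‖ψ‖ ≤ (ρ ^ 2)⁻¹ * ρ := by gcongr
      _ = ρ⁻¹ := by field_simp
  · have h1 := hψ ⟨u w, w, rfl⟩
    have h2 : g ⟨u w, w, rfl⟩ = f w := by
      have : (LinearEquiv.ofInjective u hinj).symm ⟨u w, w, rfl⟩ = w := by
        rw [LinearEquiv.symm_apply_eq]; rfl
      simp [g, this]
    simp only [smul_apply, smul_eq_mul]
    rw [← h2, ← h1]

/-- Finite-dimensional subspaces `V` of `E` extend almost isometrically along the embeddings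
`v ↦ (v, φ v, …, φ v)` into `V ⊕_∞ ℓ_∞^N`, for functionals `φ` of norm less than one. -/
def HasSupExtensions (E : Type*) [NormedAddCommGroup E] [NormedSpace ℝ E] : Prop :=
  ∀ (V : Submodule ℝ E) [FiniteDimensional ℝ V] (φ : E →L[ℝ] ℝ), ‖φ‖ < 1 →
    ∀ (N : ℕ) (ρ : ℝ), 1 < ρ → ∃ u : (V × (Fin N → ℝ)) →ₗ[ℝ] E,
      (∀ w, ‖w‖ ≤ ρ * ‖u w‖ ∧ ‖u w‖ ≤ ρ * ‖w‖) ∧ ∀ v : V, u (v, fun _ => φ v) = v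

/-- The function `p ≥ 0` is pointwise dominated by images of unit-ball vectors on which `φ` is
at most `δ`, taken from one finite-dimensional subspace. -/
def DominatedOff {E K : Type*} [NormedAddCommGroup E] [NormedSpace ℝ E] [TopologicalSpace K]
    [CompactSpace K] (e : E →L[ℝ] C(K, ℝ)) (δ : ℝ) (φ : E →L[ℝ] ℝ) (p : C(K, ℝ)) : Prop :=
  (∀ k, 0 ≤ p k) ∧ ∃ V : Submodule ℝ E, FiniteDimensional ℝ V ∧
    ∀ k, ∃ b ∈ V, ‖b‖ ≤ 1 ∧ |φ b| ≤ δ ∧ p k ≤ e b k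

theorem exists_inv_close {c d s t : ℝ} (hcd : c < d) (hst : s < t) :
    ∃ ρ : ℝ, 1 < ρ ∧ c < (ρ ^ 2)⁻¹ * d ∧ s < (ρ ^ 3)⁻¹ * t := by
  have h1 : ∀ᶠ r : ℝ in 𝓝 1, c < (r ^ 2)⁻¹ * d := by
    have : ContinuousAt (fun r : ℝ => (r ^ 2)⁻¹ * d) 1 := by
      refine ((continuousAt_id.pow 2).inv₀ ?_).mul continuousAt_const
      simp
    exact this.eventually (lt_mem_nhds (by simpa using hcd))
  have h2 : ∀ᶠ r : ℝ in 𝓝 1, s < (r ^ 3)⁻¹ * t := by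
    have : ContinuousAt (fun r : ℝ => (r ^ 3)⁻¹ * t) 1 := by
      refine ((continuousAt_id.pow 3).inv₀ ?_).mul continuousAt_const
      simp
    exact this.eventually (lt_mem_nhds (by simpa using hst))
  have h3 : ∀ᶠ r : ℝ in 𝓝[>] 1, 1 < r := self_mem_nhdsWithin
  obtain ⟨ρ, ha, hb, hc⟩ :=
    (h3.and ((h1.and h2).filter_mono nhdsWithin_le_nhds)).exists
  exact ⟨ρ, ha, hb, hc⟩

theorem exists_dominatedOff_step {E K : Type*} [NormedAddCommGroup E] [NormedSpace ℝ E]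
    [TopologicalSpace K] [CompactSpace K] (hE : HasSupExtensions E)
    (e : E →L[ℝ] C(K, ℝ)) (he : ‖e‖ ≤ 1) (π : C(K, ℝ) →L[ℝ] E) (hπ : ∀ x, π (e x) = x)
    (h : C(K, ℝ)) (hh : ‖h‖ ≤ 1) {δ η γ : ℝ} (hδ : 0 < δ) (hδ1 : δ ≤ 1) (hγ : 0 < γ)
    (φ : E →L[ℝ] ℝ) (hφ : ‖φ‖ < 1) (hφh : ‖π‖ - η < φ (π h)) (p : C(K, ℝ))
    (hp : DominatedOff e δ φ p) :
    ∃ (φ' : E →L[ℝ] ℝ) (p' : C(K, ℝ)), ‖φ'‖ < 1 ∧ ‖π‖ - η < φ' (π h) ∧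
      DominatedOff e δ φ' p' ∧
      φ (π (h * p)) + 1 - γ - 2 * η - δ * ‖π‖ ≤ φ' (π (h * p')) := by
  classical
  obtain ⟨hp0, V, hV, hpV⟩ := hp
  obtain ⟨ρ, hρ, hρ2, hρ3⟩ := exists_inv_close hφh
    (show φ (π (h * p)) + 1 - γ < φ (π (h * p)) + 1 by linarith)
  have hρ0 : 0 < ρ := by linarith
  obtain ⟨M, hM⟩ := exists_nat_one_div_lt hδ
  set A : Submodule ℝ E := V ⊔ Submodule.span ℝ {π h, π (h * p)} with hA
  have hVA : V ≤ A := le_sup_left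
  have : FiniteDimensional ℝ (Submodule.span ℝ {π h, π (h * p)}) :=
    FiniteDimensional.span_of_finite ℝ (by simp)
  have : FiniteDimensional ℝ A := Submodule.finiteDimensional_sup _ _
  have hyA : π h ∈ A := le_sup_right (a := V) (Submodule.subset_span (by simp))
  have hzA : π (h * p) ∈ A := le_sup_right (a := V) (Submodule.subset_span (by simp))
  obtain ⟨u, hu, huφ⟩ := hE A φ hφ (M + 1) ρ hρ
  have hcoord : ∀ i : Fin (M + 1), ∃ ψ : E →L[ℝ] ℝ, ‖ψ‖ ≤ ρ⁻¹ ∧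
      ∀ w, ψ (u w) = (ρ ^ 2)⁻¹ * w.2 i := by
    intro i
    let f : (A × (Fin (M + 1) → ℝ)) →L[ℝ] ℝ :=
      (ContinuousLinearMap.proj i).comp (ContinuousLinearMap.snd ℝ _ _)
    have hf : ‖f‖ ≤ 1 := by
      refine f.opNorm_le_bound zero_le_one fun w => ?_
      rw [one_mul]
      exact (norm_le_pi_norm w.2 i).trans (norm_snd_le w)
    exact exists_functionals hρ u (fun w => (hu w).1) f hf
  choose ψ hψn hψ using hcoord
  have hψA : ∀ i, ∀ a ∈ A, ψ i a = (ρ ^ 2)⁻¹ * φ a := by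
    intro i a ha
    have := hψ i (⟨a, ha⟩, fun _ => φ a)
    rwa [huφ ⟨a, ha⟩] at this
  have hρinv : ρ⁻¹ < 1 := inv_lt_one_of_one_lt₀ hρ
  have hψ1 : ∀ i, ‖ψ i‖ ≤ 1 := fun i => (hψn i).trans hρinv.le
  have heval : ∀ (x : E) (k : K), |e x k| ≤ ‖x‖ := fun x k =>
    ((e x).norm_coe_le_norm k).trans ((e.le_of_opNorm_le he x).trans_eq (one_mul _))
  let x : Fin (M + 1) → E := fun i => u (0, Pi.single i 1)
  let T : C(K, ℝ) := Finset.univ.sup' Finset.univ_nonempty fun i => |e (x i)|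
  have hT : ∀ i k, |e (x i) k| ≤ T k := by
    intro i k
    simp only [T, ContinuousMap.sup'_apply]
    exact Finset.le_sup' (fun i => |e (x i)| k) (Finset.mem_univ i)
  let p' : C(K, ℝ) := (ρ⁻¹ • (p + T) - ContinuousMap.const K δ) ⊔ 0
  have hp'k : ∀ k, p' k = max (ρ⁻¹ * (p k + T k) - δ) 0 := fun k => rfl
  let φ' : E →L[ℝ] ℝ := ((M : ℝ) + 1)⁻¹ • ∑ i, ψ i
  have hM0 : (0 : ℝ) < (M : ℝ) + 1 := by positivity
  have hφ'a : ∀ a, φ' a = ((M : ℝ) + 1)⁻¹ * ∑ i, ψ i a := by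
    intro a
    simp [φ']
  have hφ'n : ‖φ'‖ < 1 := by
    refine lt_of_le_of_lt ?_ hρinv
    have h1 : ‖∑ i, ψ i‖ ≤ ((M : ℝ) + 1) * ρ⁻¹ := by
      refine (norm_sum_le_of_le _ fun i _ => hψn i).trans_eq ?_
      simp
    calc ‖φ'‖ = ((M : ℝ) + 1)⁻¹ * ‖∑ i, ψ i‖ := by
          simp only [φ', norm_smul]
          rw [Real.norm_of_nonneg (by positivity)]
      _ ≤ ((M : ℝ) + 1)⁻¹ * (((M : ℝ) + 1) * ρ⁻¹) := by gcongr
      _ = ρ⁻¹ := by field_simp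
  have hφ'h : φ' (π h) = (ρ ^ 2)⁻¹ * φ (π h) := by
    rw [hφ'a, Finset.sum_congr rfl fun i _ => hψA i _ hyA]
    simp only [Finset.sum_const, Finset.card_univ, Fintype.card_fin, nsmul_eq_mul]
    push_cast
    field_simp
  have hdom : ∀ k, ∃ b ∈ LinearMap.range u, ‖b‖ ≤ 1 ∧ |φ' b| ≤ δ ∧ p' k ≤ e b k := by
    intro k
    rw [hp'k]
    by_cases hk : ρ⁻¹ * (p k + T k) - δ ≤ 0
    · refine ⟨0, zero_mem _, by simp, by simpa using hδ.le, ?_⟩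
      simpa using hk
    rw [max_eq_left (not_le.1 hk).le]
    obtain ⟨b, hbV, hb1, hbδ, hpb⟩ := hpV k
    obtain ⟨i, -, hi⟩ := Finset.exists_mem_eq_sup' Finset.univ_nonempty
      fun i => |e (x i)| k
    have hTi : T k = |e (x i) k| := by
      simp only [T, ContinuousMap.sup'_apply]
      exact hi
    obtain ⟨s, hs1, hs⟩ : ∃ s : ℝ, |s| = 1 ∧ s * e (x i) k = |e (x i) k| := by
      rcases le_total 0 (e (x i) k) with h0 | h0
      · exact ⟨1, by simp, by rw [abs_of_nonneg h0, one_mul]⟩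
      · exact ⟨-1, by simp, by rw [abs_of_nonpos h0]; ring⟩
    let w : A × (Fin (M + 1) → ℝ) := (⟨b, hVA hbV⟩, Pi.single i s)
    have hw : ‖w‖ ≤ 1 := by
      refine max_le hb1 ?_
      show ‖(Pi.single i s : Fin (M + 1) → ℝ)‖ ≤ 1
      rw [Pi.norm_single, Real.norm_eq_abs, hs1]
    have hρw : ‖ρ⁻¹ • u w‖ ≤ 1 := by
      rw [norm_smul, Real.norm_of_nonneg (by positivity)]
      calc ρ⁻¹ * ‖u w‖ ≤ ρ⁻¹ * (ρ * ‖w‖) := by gcongr; exact (hu w).2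
        _ = ‖w‖ := by field_simp
        _ ≤ 1 := hw
    refine ⟨ρ⁻¹ • u w, Submodule.smul_mem _ _ ⟨w, rfl⟩, hρw, ?_, ?_⟩
    · have h1 : φ' (ρ⁻¹ • u w) = (ρ ^ 3)⁻¹ * (((M : ℝ) + 1)⁻¹ * s) := by
        rw [map_smul, hφ'a, Finset.sum_congr rfl fun j _ => hψ j w, ← Finset.mul_sum]
        have : ∑ j, w.2 j = s := by simp [w]
        rw [this, smul_eq_mul]
        field_simp
      rw [h1, abs_mul, abs_mul, hs1, abs_of_pos (by positivity : 0 < (ρ ^ 3)⁻¹),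
        abs_of_pos (by positivity : 0 < ((M : ℝ) + 1)⁻¹), mul_one]
      have h2 : (ρ ^ 3)⁻¹ ≤ 1 := inv_le_one_of_one_le₀ (one_le_pow₀ hρ.le)
      calc (ρ ^ 3)⁻¹ * ((M : ℝ) + 1)⁻¹ ≤ 1 * ((M : ℝ) + 1)⁻¹ := by gcongr
        _ ≤ δ := by rw [one_mul, ← one_div]; exact hM.le
    · have h1 : u w = b + s • x i - φ b • u (0, fun _ => 1) := by
        have h2 : u (⟨b, hVA hbV⟩, fun _ => φ b) = b := huφ ⟨b, hVA hbV⟩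
        have hw' : w = (⟨b, hVA hbV⟩, fun _ => φ b) + s • (0, Pi.single i 1) -
            φ b • (0, fun _ => 1) := by
          refine Prod.ext ?_ (funext fun j => ?_)
          · simp [w]
          · by_cases hj : j = i
            · subst hj
              simp [w]
            · simp [w, hj]
        simp only [x]
        rw [hw', map_sub, map_add, map_smul, map_smul, h2]
      have h3 : |φ b * e (u (0, fun _ => 1)) k| ≤ δ * ρ := by
        rw [abs_mul]
        refine mul_le_mul hbδ ?_ (abs_nonneg _) hδ.le
        refine (heval _ k).trans ((hu _).2.trans ?_)
        refine mul_le_of_le_one_right hρ0.le ?_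
        refine max_le (by simp) ?_
        exact (pi_norm_le_iff_of_nonneg zero_le_one).2 fun _ => by simp
      have h4 : e (ρ⁻¹ • u w) k =
          ρ⁻¹ * (e b k + s * e (x i) k - φ b * e (u (0, fun _ => 1)) k) := by
        rw [h1]
        simp
      rw [h4, hs, hTi]
      have h5 : ρ⁻¹ * (p k + |e (x i) k|) - δ = ρ⁻¹ * (p k + |e (x i) k| - δ * ρ) := by
        field_simp
      rw [h5]
      refine mul_le_mul_of_nonneg_left ?_ (by positivity)
      linarith [(abs_le.1 h3).2]
  have hp'1 : ∀ k, p' k ≤ 1 := by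
    intro k
    obtain ⟨b, -, hb, -, hpb⟩ := hdom k
    exact hpb.trans ((le_abs_self _).trans ((heval b k).trans hb))
  have hψp' : ∀ i, φ (π (h * p)) + 1 - γ - 2 * η - δ * ‖π‖ ≤ ψ i (π (h * p')) := by
    intro i
    have hyi : ψ i (π h) = (ρ ^ 2)⁻¹ * φ (π h) := hψA i _ hyA
    have hzi : ψ i (π (h * p)) = (ρ ^ 2)⁻¹ * φ (π (h * p)) := hψA i _ hzA
    have hyle : ψ i (π h) ≤ ‖π‖ := by
      refine (le_abs_self _).trans (((ψ i).le_of_opNorm_le (hψ1 i) _).trans ?_)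
      rw [one_mul]
      exact π.unit_le_opNorm _ hh
    have key := apply_le_apply_mul_add π (ψ i) (hψ1 i) h hh
      ((1 / 2 : ℝ) • (p' - ρ⁻¹ • p + ContinuousMap.const K δ)) ((1 / 2 * ρ⁻¹) • e (x i))
      (fun k => ?_) (fun k => ?_)
    · have h1 : ψ i (π ((1 / 2 * ρ⁻¹) • e (x i))) = 1 / 2 * (ρ ^ 3)⁻¹ := by
        rw [map_smul, map_smul, hπ, hψ i]
        simp
        field_simp
      have h2 : h * ((1 / 2 : ℝ) • (p' - ρ⁻¹ • p + ContinuousMap.const K δ)) =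
          (1 / 2 : ℝ) • (h * p' - ρ⁻¹ • (h * p) + δ • h) := by
        ext k
        simp
        ring
      rw [h1, h2] at key
      simp only [map_smul, map_add, map_sub, smul_eq_mul] at key
      have h3 : ρ⁻¹ * ψ i (π (h * p)) = (ρ ^ 3)⁻¹ * φ (π (h * p)) := by
        rw [hzi]
        field_simp
      have h4 : δ * ψ i (π h) ≤ δ * ‖π‖ := by gcongr
      rw [← hyi] at hρ2
      linarith
    · have h1 : |((1 / 2 * ρ⁻¹) • e (x i)) k| = 1 / 2 * (ρ⁻¹ * |e (x i) k|) := by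
        simp [abs_mul, abs_of_pos hρ0]
        ring
      have h2 : ((1 / 2 : ℝ) • (p' - ρ⁻¹ • p + ContinuousMap.const K δ)) k =
          1 / 2 * (p' k - ρ⁻¹ * p k + δ) := rfl
      rw [h1, h2]
      have h3 : ρ⁻¹ * |e (x i) k| ≤ ρ⁻¹ * T k := by gcongr; exact hT i k
      have h4 : ρ⁻¹ * (p k + T k) - δ ≤ p' k := by
        rw [hp'k]
        exact le_max_left _ _
      linarith
    · have h2 : ((1 / 2 : ℝ) • (p' - ρ⁻¹ • p + ContinuousMap.const K δ)) k =
          1 / 2 * (p' k - ρ⁻¹ * p k + δ) := rfl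
      rw [h2]
      have h3 : 0 ≤ ρ⁻¹ * p k := mul_nonneg (by positivity) (hp0 k)
      linarith [hp'1 k]
  refine ⟨φ', p', hφ'n, by rwa [hφ'h], ⟨fun k => le_max_right _ _, _, inferInstance, hdom⟩, ?_⟩
  rw [hφ'a, inv_mul_eq_div, le_div_iff₀ hM0]
  calc _ = ∑ _i : Fin (M + 1), (φ (π (h * p)) + 1 - γ - 2 * η - δ * ‖π‖) := by
        simp
        ring
    _ ≤ _ := Finset.sum_le_sum fun i _ => hψp' i

theorem opNorm_mul_pos_of_leftInverse {E F : Type*} [NormedAddCommGroup E] [NormedSpace ℝ E]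
    [Nontrivial E] [NormedAddCommGroup F] [NormedSpace ℝ F] (e : E →L[ℝ] F) (π : F →L[ℝ] E)
    (hπe : ∀ x, π (e x) = x) : 0 < ‖π‖ * ‖e‖ := by
  obtain ⟨x, hx⟩ := exists_ne (0 : E)
  refine mul_pos (norm_pos_iff.2 ?_) (norm_pos_iff.2 ?_)
  all_goals
    rintro rfl
    exact hx (by simpa using (hπe x).symm)

theorem not_complemented_of_hasSupExtensions {E K : Type*} [NormedAddCommGroup E]
    [NormedSpace ℝ E] [Nontrivial E] [TopologicalSpace K] [CompactSpace K]
    (hE : HasSupExtensions E) (e : E →L[ℝ] C(K, ℝ)) (π : C(K, ℝ) →L[ℝ] E) :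
    ¬ ∀ x, π (e x) = x := by
  intro hπe
  have he0 : 0 < ‖e‖ := pos_of_mul_pos_right (opNorm_mul_pos_of_leftInverse e π hπe)
    (ContinuousLinearMap.opNorm_nonneg _)
  wlog he : ‖e‖ ≤ 1 generalizing e π
  · have hn : ‖‖e‖⁻¹ • e‖ ≤ 1 := by
      refine ContinuousLinearMap.opNorm_le_bound _ zero_le_one fun x => ?_
      rw [smul_apply, norm_smul, norm_inv, Real.norm_of_nonneg he0.le, inv_mul_le_iff₀ he0,
        one_mul]
      exact e.le_opNorm x
    have hπe' : ∀ x, (‖e‖ • π) ((‖e‖⁻¹ • e) x) = x := fun x => by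
      simp [hπe, smul_smul, he0.ne']
    exact this (‖e‖⁻¹ • e) (‖e‖ • π) hπe' (pos_of_mul_pos_right
      (opNorm_mul_pos_of_leftInverse _ _ hπe') (ContinuousLinearMap.opNorm_nonneg _)) hn
  have hπ0 : 0 < ‖π‖ := pos_of_mul_pos_left
    (opNorm_mul_pos_of_leftInverse e π hπe) he0.le
  obtain ⟨h, hh, hhπ⟩ := π.exists_lt_apply_of_lt_opNorm
    (show ‖π‖ - 1 / 8 < ‖π‖ by linarith)
  obtain ⟨φ₀, hφ₀, hφ₀h⟩ := exists_dual_vector'' ℝ (π h)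
  have hφ₀h' : φ₀ (π h) = ‖π h‖ := hφ₀h
  obtain ⟨ρ, hρ, hρ2, -⟩ := exists_inv_close hhπ zero_lt_one
  have hρ0 : 0 < ρ := by linarith
  set δ : ℝ := min 1 (1 / (8 * ‖π‖)) with hδ
  have hδ0 : 0 < δ := lt_min one_pos (by positivity)
  have hδπ : δ * ‖π‖ ≤ 1 / 8 := calc
    δ * ‖π‖ ≤ 1 / (8 * ‖π‖) * ‖π‖ := by gcongr; exact min_le_right _ _
    _ = 1 / 8 := by field_simp
  have hiter : ∀ n : ℕ, ∃ (φ : E →L[ℝ] ℝ) (p : C(K, ℝ)), ‖φ‖ < 1 ∧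
      ‖π‖ - 1 / 8 < φ (π h) ∧ DominatedOff e δ φ p ∧ (n : ℝ) / 2 ≤ φ (π (h * p)) := by
    intro n
    induction n with
    | zero =>
      refine ⟨(ρ ^ 2)⁻¹ • φ₀, 0, ?_, ?_, ⟨by simp, ⊥, inferInstance, fun k => ⟨0, by simp [hδ0.le]⟩⟩,
        by simp⟩
      · rw [norm_smul, Real.norm_of_nonneg (by positivity)]
        calc (ρ ^ 2)⁻¹ * ‖φ₀‖ ≤ (ρ ^ 2)⁻¹ * 1 := by gcongr
          _ < 1 := by rw [mul_one]; exact inv_lt_one_of_one_lt₀ (one_lt_pow₀ hρ two_ne_zero)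
      · simpa [hφ₀h'] using hρ2
    | succ n ih =>
      obtain ⟨φ, p, h1, h2, h3, h4⟩ := ih
      obtain ⟨φ', p', h1', h2', h3', h4'⟩ := exists_dominatedOff_step hE e he π hπe h hh.le hδ0
        (min_le_left _ _) (show (0 : ℝ) < 1 / 8 by norm_num) φ h1 h2 p h3
      refine ⟨φ', p', h1', h2', h3', ?_⟩
      push_cast
      linarith
  obtain ⟨n, hn⟩ := exists_nat_gt (2 * ‖π‖)
  obtain ⟨φ, p, h1, -, ⟨hp0, V, -, hpV⟩, h4⟩ := hiter n
  have hp1 : ‖p‖ ≤ 1 := by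
    rw [ContinuousMap.norm_le _ zero_le_one]
    intro k
    obtain ⟨b, -, hb, -, hpb⟩ := hpV k
    rw [Real.norm_of_nonneg (hp0 k)]
    refine hpb.trans ((le_abs_self _).trans (((e b).norm_coe_le_norm k).trans ?_))
    exact e.unit_le_opNorm b hb |>.trans he
  have hle : φ (π (h * p)) ≤ ‖π‖ := by
    refine (le_abs_self _).trans ((φ.le_of_opNorm_le h1.le _).trans ?_)
    rw [one_mul]
    refine π.unit_le_opNorm _ ((norm_mul_le _ _).trans ?_)
    exact mul_le_one₀ hh.le (norm_nonneg _) hp1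
  linarith

theorem AlmostUnivDispFinDim.exists_sup_extension {U : Type*} [NormedAddCommGroup U]
    [NormedSpace ℝ U] (hU : AlmostUnivDispFinDim U) {V : Type*} [AddCommGroup V] [Module ℝ V]
    [FiniteDimensional ℝ V] (L : V →ₗ[ℝ] U) (hL : Function.Injective L) (ψ : V →ₗ[ℝ] ℝ)
    (hψ : ∀ v, |ψ v| ≤ ‖L v‖) (N : ℕ) {ε : ℝ} (hε : 0 < ε) :
    ∃ u : (V × (Fin N → ℝ)) →ₗ[ℝ] U,
      (∀ w, (1 + ε)⁻¹ * max ‖L w.1‖ ‖w.2‖ ≤ ‖u w‖ ∧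
        ‖u w‖ ≤ (1 + ε) * max ‖L w.1‖ ‖w.2‖) ∧
      ∀ v, u (v, fun _ => ψ v) = L v := by
  let r : V ≃ₗ[ℝ] (Fin (Module.finrank ℝ V) →₀ ℝ) := (Module.finBasis ℝ V).repr
  let L' : (Fin (Module.finrank ℝ V) →₀ ℝ) →ₗ[ℝ] U := L ∘ₗ r.symm.toLinearMap
  have hL' : Function.Injective L' := hL.comp r.symm.injective
  let _ : NormedAddCommGroup (Fin (Module.finrank ℝ V) →₀ ℝ) :=
    NormedAddCommGroup.induced _ _ L' hL'
  let _ : NormedSpace ℝ (Fin (Module.finrank ℝ V) →₀ ℝ) := NormedSpace.induced ℝ _ _ L'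
  have hnorm : ∀ a : Fin (Module.finrank ℝ V) →₀ ℝ, ‖a‖ = ‖L' a‖ := fun _ => rfl
  let ψ' : (Fin (Module.finrank ℝ V) →₀ ℝ) →ₗ[ℝ] ℝ := ψ ∘ₗ r.symm.toLinearMap
  let j : (Fin (Module.finrank ℝ V) →₀ ℝ) →ₗᵢ[ℝ]
      (Fin (Module.finrank ℝ V) →₀ ℝ) × (Fin N → ℝ) :=
    { toLinearMap := LinearMap.id.prod (LinearMap.pi fun _ => ψ')
      norm_map' := fun a => by
        refine max_eq_left ((pi_norm_le_iff_of_nonneg (norm_nonneg a)).2 fun _ => ?_)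
        exact hψ (r.symm a) }
  obtain ⟨u, hu, huj⟩ := hU _ _ ⟨L', fun a => (hnorm a).symm⟩ j ε hε
  refine ⟨u ∘ₗ (r.toLinearMap.prodMap LinearMap.id), fun w => ?_, fun v => ?_⟩
  · have h1 : ‖(r w.1, w.2)‖ = max ‖L w.1‖ ‖w.2‖ := by
      rw [Prod.norm_def, hnorm]
      simp [L']
    have h2 := hu (r w.1, w.2)
    rw [h1] at h2
    exact h2
  · have h1 : j (r v) = (r v, fun _ => ψ v) := by
      refine Prod.ext rfl (funext fun _ => ?_)
      exact congrArg ψ (r.symm_apply_apply v)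
    have h2 := huj (r v)
    rw [h1] at h2
    simpa [L'] using h2

theorem eventually_forall_mul_norm_le {ι Y V : Type*} [NormedAddCommGroup Y] [NormedSpace ℝ Y]
    [NormedAddCommGroup V] [NormedSpace ℝ V] [FiniteDimensional ℝ V] (l : Filter ι)
    (T : V →L[ℝ] lp (fun _ : ι => Y) ∞) (hT : ∀ v, ∀ r < ‖v‖, ∀ᶠ i in l, r < ‖T v i‖)
    {c : ℝ} (hc : c < 1) : ∀ᶠ i in l, ∀ v, c * ‖v‖ ≤ ‖T v i‖ := by
  have key : ∀ᶠ i in l, ∀ v ∈ Metric.sphere (0 : V) 1, c ≤ ‖T v i‖ := by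
    have : ProperSpace V := FiniteDimensional.proper_real V
    refine (isCompact_sphere (0 : V) 1).induction_on (by simp) (fun s t hst h => ?_)
      (fun s t hs ht => ?_) (fun v hv => ?_)
    · exact h.mono fun i hi v hv => hi v (hst hv)
    · filter_upwards [hs, ht] with i h1 h2 v hv
      exact hv.elim (h1 v) (h2 v)
    · have hv1 : ‖v‖ = 1 := by simpa using hv
      refine ⟨T ⁻¹' Metric.ball (T v) ((1 - c) / 2), mem_nhdsWithin_of_mem_nhds
        (T.continuous.continuousAt (Metric.ball_mem_nhds _ (by linarith))), ?_⟩
      filter_upwards [hT v ((1 + c) / 2) (by linarith)] with i hi w hw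
      have h1 : ‖T v - T w‖ < (1 - c) / 2 := by
        rw [← dist_eq_norm, dist_comm]
        exact hw
      have h2 : ‖T v i - T w i‖ ≤ ‖T v - T w‖ :=
        lp.norm_apply_le_norm ENNReal.top_ne_zero (T v - T w) i
      linarith [norm_sub_norm_le (T v i) (T w i)]
  filter_upwards [key] with i hi v
  rcases eq_or_ne v 0 with rfl | hv
  · simp
  · have hv0 : 0 < ‖v‖ := norm_pos_iff.2 hv
    have h1 := hi (‖v‖⁻¹ • v) (by simp [norm_smul, hv0.ne'])
    rw [map_smul, lp.coeFn_smul, Pi.smul_apply, norm_smul, norm_inv, norm_norm,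
      le_inv_mul_iff₀ hv0] at h1
    linarith

theorem hasSupExtensions_of_almostUnivDispFinDim {ι Y E : Type*} [NormedAddCommGroup Y]
    [NormedSpace ℝ Y] [NormedAddCommGroup E] [NormedSpace ℝ E] (hY : AlmostUnivDispFinDim Y)
    (𝒰 : Ultrafilter ι) (P : lp (fun _ : ι => Y) ∞ →ₗ[ℝ] E) (hP : Function.Surjective P)
    (hle : ∀ g r, 0 ≤ r → (∀ᶠ i in (𝒰 : Filter ι), ‖g i‖ ≤ r) → ‖P g‖ ≤ r)
    (hge : ∀ g r, (∀ᶠ i in (𝒰 : Filter ι), r ≤ ‖g i‖) → r ≤ ‖P g‖) :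
    HasSupExtensions E := by
  classical
  intro V _ φ hφ N ρ hρ
  have hlt : ∀ g, ∀ r < ‖P g‖, ∀ᶠ i in (𝒰 : Filter ι), r < ‖g i‖ := by
    intro g r hr
    by_contra hcon
    rw [← Ultrafilter.eventually_not] at hcon
    have hcon' : ∀ᶠ i in (𝒰 : Filter ι), ‖g i‖ ≤ r := hcon.mono fun i hi => not_lt.1 hi
    obtain ⟨i, hi⟩ := hcon'.exists
    exact (hle g r ((norm_nonneg _).trans hi) hcon').not_gt hr
  have hgt : ∀ g, ∀ r > ‖P g‖, ∀ᶠ i in (𝒰 : Filter ι), ‖g i‖ < r := by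
    intro g r hr
    by_contra hcon
    rw [← Ultrafilter.eventually_not] at hcon
    exact (hge g r (hcon.mono fun i hi => not_lt.1 hi)).not_gt hr
  obtain ⟨s, hs⟩ := P.exists_rightInverse_of_surjective (LinearMap.range_eq_top.2 hP)
  have hPs : ∀ x, P (s x) = x := fun x => LinearMap.congr_fun hs x
  let T : V →L[ℝ] lp (fun _ : ι => Y) ∞ := (s ∘ₗ V.subtype).toContinuousLinearMap
  have hPT : ∀ v, P (T v) = v := fun v => hPs v
  obtain ⟨c, hc, hc1⟩ := exists_between hφ
  have hc0 : 0 < c := (norm_nonneg _).trans_lt hc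
  let L : ι → V →ₗ[ℝ] Y := fun i =>
    { toFun := fun v => T v i
      map_add' := fun v w => by simp
      map_smul' := fun a v => by simp }
  have hgood : ∀ᶠ i in (𝒰 : Filter ι), ∃ u : (V × (Fin N → ℝ)) →ₗ[ℝ] Y,
      (∀ w, ρ⁻¹ * max ‖T w.1 i‖ ‖w.2‖ ≤ ‖u w‖ ∧ ‖u w‖ ≤ ρ * max ‖T w.1 i‖ ‖w.2‖) ∧
      ∀ v, u (v, fun _ => φ v) = T v i := by
    filter_upwards [eventually_forall_mul_norm_le (𝒰 : Filter ι) T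
      (fun v r hr => hlt _ r (by rwa [hPT])) hc1] with i hi
    have hinj : Function.Injective (L i) := by
      rw [injective_iff_map_eq_zero]
      intro v hv
      have h1 := hi v
      rw [show T v i = 0 from hv, norm_zero] at h1
      exact norm_le_zero_iff.1 (nonpos_of_mul_nonpos_right h1 hc0)
    have hψ : ∀ v : V, |(φ.toLinearMap ∘ₗ V.subtype) v| ≤ ‖L i v‖ := fun v =>
      ((φ.le_opNorm v).trans (mul_le_mul_of_nonneg_right hc.le (norm_nonneg _))).trans (hi v)
    have h1 := hY.exists_sup_extension (L i) hinj _ hψ N (sub_pos.2 hρ)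
    rw [add_sub_cancel] at h1
    exact h1
  have hρ0 : 0 < ρ := by linarith
  let u : ι → (V × (Fin N → ℝ)) →ₗ[ℝ] Y := fun i => if h : ∃ u : (V × (Fin N → ℝ)) →ₗ[ℝ] Y,
      (∀ w, ρ⁻¹ * max ‖T w.1 i‖ ‖w.2‖ ≤ ‖u w‖ ∧ ‖u w‖ ≤ ρ * max ‖T w.1 i‖ ‖w.2‖) ∧
      ∀ v, u (v, fun _ => φ v) = T v i then h.choose else 0
  have hu : ∀ᶠ i in (𝒰 : Filter ι), (∀ w, ρ⁻¹ * max ‖T w.1 i‖ ‖w.2‖ ≤ ‖u i w‖) ∧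
      ∀ v, u i (v, fun _ => φ v) = T v i := by
    filter_upwards [hgood] with i hi
    simp only [u, dif_pos hi]
    exact ⟨fun w => (hi.choose_spec.1 w).1, hi.choose_spec.2⟩
  have huρ : ∀ i w, ‖u i w‖ ≤ ρ * max ‖T w.1 i‖ ‖w.2‖ := by
    intro i w
    simp only [u]
    split_ifs with h
    · exact (h.choose_spec.1 w).2
    · simp only [LinearMap.zero_apply, norm_zero]
      positivity
  have hmem : ∀ w, Memℓp (fun i => u i w) ∞ := by
    intro w
    refine memℓp_infty ⟨ρ * max ‖T w.1‖ ‖w.2‖, ?_⟩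
    rintro _ ⟨i, rfl⟩
    refine (huρ i w).trans ?_
    gcongr
    exact lp.norm_apply_le_norm ENNReal.top_ne_zero (T w.1) i
  let S : (V × (Fin N → ℝ)) →ₗ[ℝ] lp (fun _ : ι => Y) ∞ :=
    { toFun := fun w => ⟨fun i => u i w, hmem w⟩
      map_add' := fun v w => by
        ext i
        exact map_add (u i) v w
      map_smul' := fun a w => by
        ext i
        exact map_smul (u i) a w }
  have hS : ∀ w i, S w i = u i w := fun _ _ => rfl
  refine ⟨P ∘ₗ S, fun w => ⟨?_, ?_⟩, fun v => ?_⟩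
  · refine le_of_forall_lt_imp_le_of_dense fun r hr => ?_
    rw [← inv_mul_le_iff₀ hρ0]
    refine hge _ _ ?_
    have h1 : ∀ᶠ i in (𝒰 : Filter ι), r ≤ max ‖T w.1 i‖ ‖w.2‖ := by
      rcases lt_max_iff.1 hr with h | h
      · filter_upwards [hlt (T w.1) r (by rwa [hPT])] with i hi
        exact hi.le.trans (le_max_left _ _)
      · exact Filter.Eventually.of_forall fun i => h.le.trans (le_max_right _ _)
    filter_upwards [h1, hu] with i h1 h2
    refine le_trans ?_ (h2.1 w)
    gcongr
  · rw [← inv_mul_le_iff₀ hρ0]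
    refine le_of_forall_gt_imp_ge_of_dense fun r hr => ?_
    rw [inv_mul_le_iff₀ hρ0]
    refine hle _ _ (mul_nonneg hρ0.le ((norm_nonneg _).trans hr.le)) ?_
    filter_upwards [hgt (T w.1) r (by rw [hPT]; exact (norm_fst_le w).trans_lt hr)] with i hi
    refine (huρ i w).trans ?_
    gcongr
    exact max_le hi.le ((norm_snd_le w).trans hr.le)
  · refine Eq.trans ?_ (hPT v)
    rw [LinearMap.comp_apply, ← sub_eq_zero, ← map_sub, ← norm_le_zero_iff]
    refine hle _ _ le_rfl ?_
    filter_upwards [hu] with i hi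
    rw [lp.coeFn_sub, Pi.sub_apply, hS, hi.2 v, sub_self, norm_zero]

theorem HasSupExtensions.nontrivial {E : Type*} [NormedAddCommGroup E] [NormedSpace ℝ E]
    (hE : HasSupExtensions E) : Nontrivial E := by
  obtain ⟨u, hu, -⟩ := hE ⊥ 0 (by simp) 1 2 one_lt_two
  refine ⟨u (0, 1), 0, fun h => ?_⟩
  have h1 := (hu (0, 1)).1
  rw [h, norm_zero, mul_zero, norm_le_zero_iff] at h1
  simpa using congrFun (congrArg Prod.snd h1) 0

theorem norm_mkQ_nullUltraIdeal_le {𝒰 : Ultrafilter I} (g : lp (fun _ : I => X) ∞) {r : ℝ}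
    (hr : 0 ≤ r) (hg : ∀ᶠ i in (𝒰 : Filter I), ‖g i‖ ≤ r) :
    ‖(nullUltraIdeal I X 𝒰).mkQ g‖ ≤ r := by
  classical
  have hbd : ∀ i, ‖if ‖g i‖ ≤ r then g i else 0‖ ≤ r := by
    intro i
    split_ifs with h
    · exact h
    · simpa using hr
  let g' : lp (fun _ : I => X) ∞ := ⟨fun i => if ‖g i‖ ≤ r then g i else 0,
    memℓp_infty ⟨r, by rintro _ ⟨i, rfl⟩; exact hbd i⟩⟩
  have hmem : g - g' ∈ nullUltraIdeal I X 𝒰 := by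
    refine Filter.Tendsto.congr' ?_ tendsto_const_nhds
    filter_upwards [hg] with i hi
    have : g' i = g i := if_pos hi
    simp [this]
  have heq : (nullUltraIdeal I X 𝒰).mkQ g = (nullUltraIdeal I X 𝒰).mkQ g' :=
    (Submodule.Quotient.eq _).2 hmem
  rw [heq]
  exact (Submodule.Quotient.norm_mk_le _ g').trans (lp.norm_le_of_forall_le hr hbd)

theorem le_norm_mkQ_nullUltraIdeal {𝒰 : Ultrafilter I} (g : lp (fun _ : I => X) ∞) {r : ℝ}
    (hg : ∀ᶠ i in (𝒰 : Filter I), r ≤ ‖g i‖) :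
    r ≤ ‖(nullUltraIdeal I X 𝒰).mkQ g‖ := by
  refine le_of_forall_pos_le_add fun ε hε => ?_
  obtain ⟨m, hm, hmn⟩ := Submodule.Quotient.norm_mk_lt ((nullUltraIdeal I X 𝒰).mkQ g) hε
  have hmem : g - m ∈ nullUltraIdeal I X 𝒰 := (Submodule.Quotient.eq _).1 hm.symm
  have hlim : Filter.Tendsto (fun i => ‖m‖ + ‖(g - m) i‖) (𝒰 : Filter I) (𝓝 (‖m‖ + 0)) :=
    tendsto_const_nhds.add hmem
  have h1 : r ≤ ‖m‖ + 0 := by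
    refine ge_of_tendsto hlim ?_
    filter_upwards [hg] with i hi
    have h2 : ‖m i‖ ≤ ‖m‖ := lp.norm_apply_le_norm ENNReal.top_ne_zero m i
    have h3 : ‖g i‖ ≤ ‖m i‖ + ‖(g - m) i‖ := by
      simpa using norm_add_le (m i) ((g - m) i)
    linarith
  linarith

/-- Ultrapowers, along countably incomplete ultrafilters, of a Banach space of almost
universal disposition for finite-dimensional spaces are not direct factors of any
`C(K)`-space. -/
theorem ultrapower_not_factor_of_CK [CompleteSpace X]
    (hX : AlmostUnivDispFinDim X) (𝒰 : Ultrafilter I)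
    (h𝒰 : 𝒰.CountablyIncomplete) :
    ∀ (K : Type) [TopologicalSpace K] [CompactSpace K] [T2Space K],
      ¬ ∃ (e : (lp (fun _ : I => X) ∞ ⧸ nullUltraIdeal I X 𝒰) →L[ℝ] C(K, ℝ))
          (π : C(K, ℝ) →L[ℝ] (lp (fun _ : I => X) ∞ ⧸ nullUltraIdeal I X 𝒰)),
        ∀ x : (lp (fun _ : I => X) ∞ ⧸ nullUltraIdeal I X 𝒰), π (e x) = x := by
  have hE : HasSupExtensions (lp (fun _ : I => X) ∞ ⧸ nullUltraIdeal I X 𝒰) :=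
    hasSupExtensions_of_almostUnivDispFinDim hX 𝒰 (nullUltraIdeal I X 𝒰).mkQ
      (Submodule.mkQ_surjective _) (fun g _ hr hg => norm_mkQ_nullUltraIdeal_le I X g hr hg)
      (fun g _ hg => le_norm_mkQ_nullUltraIdeal I X g hg)
  have := hE.nontrivial
  rintro K _ _ _ ⟨e, π, h⟩
  exact not_complemented_of_hasSupExtensions hE e π h
end
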